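/- Non-uniform Łojasiewicz inequality (unique-optimal-action form): for any deterministic optimal policy f* with a*(x) = argmax_a f*(x,a), and any parameter θ, ‖∇_θ J(f_θ)‖ ≥ (1/√|𝒳|) · ‖ν_μ^{f*}/ν_μ^{f_θ}‖_∞^{−1} · min_x f_θ(x, a*(x)) · ( J(f*) − J(f_θ) ), where ‖ν_μ^{f*}/ν_μ^{f_θ}‖_∞ = max_x ν_μ^{f*}(x)/ν_μ^{f_θ}(x). -/

import Mathlib

open MeasureTheory Filter Set
open scoped Classical

noncomputable section

def softmaxPol {X A : Type*} [Fintype A] (θ : X → A → ℝ) (x : X) (a : A) : ℝ :=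
  Real.exp (θ x a) / ∑ a', Real.exp (θ x a')

def explorePol {X A : Type*} [Fintype A] (η : ℝ) (θ : X → A → ℝ) (x : X) (a : A) : ℝ :=
  η / (Fintype.card A : ℝ) + (1 - η) * softmaxPol θ x a

def zetaN (N k : ℕ) : ℝ := (1 + (k : ℝ) / (N : ℝ))⁻¹

def etaN (N k : ℕ) : ℝ := (1 + (Real.log ((k : ℝ) / (N : ℝ) + 1)) ^ 2)⁻¹

def zetaT (t : ℝ) : ℝ := (1 + t)⁻¹

def etaT (t : ℝ) : ℝ := (1 + (Real.log (t + 1)) ^ 2)⁻¹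

def IsPolicy {X A : Type*} [Fintype A] (f : X → A → ℝ) : Prop :=
  (∀ x a, 0 ≤ f x a) ∧ ∀ x, ∑ a, f x a = 1

def ptilde {X A : Type*} (γ : ℝ) (p : X → A → X → ℝ) (μ : X → ℝ)
    (x : X) (a : A) (x' : X) : ℝ :=
  γ * p x a x' + (1 - γ) * μ x'

def actorKer {X A : Type*} (γ : ℝ) (p : X → A → X → ℝ) (μ : X → ℝ) (f : X → A → ℝ) :
    X × A → X × A → ℝ :=
  fun ξ ξ' => ptilde γ p μ ξ.1 ξ.2 ξ'.1 * f ξ'.1 ξ'.2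

def criticKer {X A : Type*} (p : X → A → X → ℝ) (g : X → A → ℝ) :
    X × A → X × A → ℝ :=
  fun ξ ξ' => p ξ.1 ξ.2 ξ'.1 * g ξ'.1 ξ'.2

def kpow {S : Type*} [Fintype S] [DecidableEq S] (K : S → S → ℝ) : ℕ → S → S → ℝ
  | 0 => fun ξ ξ' => if ξ = ξ' then 1 else 0
  | n + 1 => fun ξ ξ' => ∑ y, K ξ y * kpow K n y ξ'

def IsStationaryDist {S : Type*} [Fintype S] (K : S → S → ℝ) (d : S → ℝ) : Prop :=
  (∀ ξ, 0 ≤ d ξ) ∧ (∑ ξ, d ξ = 1) ∧ ∀ ξ', d ξ' = ∑ ξ, d ξ * K ξ ξ'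

def pathSum {X A : Type*} [Fintype X] [Fintype A] [DecidableEq X]
    (p : X → A → X → ℝ) : ℕ → X → A → X → ℝ
  | 0 => fun x _ x' => if x = x' then 1 else 0
  | 1 => fun x a x' => p x a x'
  | n + 2 => fun x a x' => ∑ x₁ : X, ∑ a₁ : A, p x a x₁ * pathSum p (n + 1) x₁ a₁ x'

theorem softmaxPol_denom_pos {X A : Type*} [Fintype A] [Nonempty A] (θ : X → A → ℝ) (x : X) :
    0 < ∑ a', Real.exp (θ x a') :=
  Finset.sum_pos (fun _ _ => Real.exp_pos _) Finset.univ_nonempty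

theorem softmaxPol_pos {X A : Type*} [Fintype A] [Nonempty A] (θ : X → A → ℝ) (x : X) (a : A) :
    0 < softmaxPol θ x a :=
  div_pos (Real.exp_pos _) (softmaxPol_denom_pos θ x)

theorem isPolicy_softmaxPol {X A : Type*} [Fintype A] [Nonempty A] (θ : X → A → ℝ) :
    IsPolicy (softmaxPol θ) := by
  refine ⟨fun x a => (softmaxPol_pos θ x a).le, fun x => ?_⟩
  unfold softmaxPol
  rw [← Finset.sum_div, div_self (softmaxPol_denom_pos θ x).ne']

theorem sum_le_of_le_add_mul_transition {X A : Type*} [Fintype X] [Fintype A]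
    {p : X → A → X → ℝ} {γ : ℝ} (hp1 : ∀ x a, ∑ x', p x a x' = 1)
    {f : X → A → ℝ} (hf : IsPolicy f) {w b : X → ℝ}
    (h : ∀ x, w x ≤ b x + γ * ∑ x', ∑ a', w x' * f x' a' * p x' a' x) :
    (1 - γ) * ∑ x, w x ≤ ∑ x, b x := by
  have h1 : ∑ x, ∑ x', ∑ a', w x' * f x' a' * p x' a' x = ∑ x, w x := by
    rw [Finset.sum_comm]
    refine Finset.sum_congr rfl fun x' _ => ?_
    rw [Finset.sum_comm]
    simp_rw [← Finset.mul_sum, hp1, mul_one, ← Finset.mul_sum, hf.2, mul_one]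
  have h2 := Finset.sum_le_sum fun x (_ : x ∈ Finset.univ) => h x
  rw [Finset.sum_add_distrib, ← Finset.mul_sum, h1] at h2
  linarith

theorem visit_nonneg {X A : Type*} [Fintype X] [Fintype A]
    {p : X → A → X → ℝ} {μ : X → ℝ} {γ : ℝ}
    (hp0 : ∀ x a x', 0 ≤ p x a x') (hp1 : ∀ x a, ∑ x', p x a x' = 1)
    (hμ0 : ∀ x, 0 ≤ μ x) (hγ : 0 < γ ∧ γ < 1)
    {f : X → A → ℝ} (hf : IsPolicy f) {n : X → ℝ}
    (hn : ∀ x, n x = μ x + γ * ∑ x', ∑ a', n x' * f x' a' * p x' a' x) (x : X) :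
    0 ≤ n x := by
  have h := sum_le_of_le_add_mul_transition hp1 hf (γ := γ) (w := fun x => max (-n x) 0)
    (b := fun _ => 0) (fun x => by
      have hpos : ∀ x' a', 0 ≤ f x' a' * p x' a' x :=
        fun x' a' => mul_nonneg (hf.1 _ _) (hp0 _ _ _)
      have h0 : 0 ≤ ∑ x', ∑ a', max (-n x') 0 * f x' a' * p x' a' x :=
        Finset.sum_nonneg fun x' _ => Finset.sum_nonneg fun a' _ => by
          rw [mul_assoc]; exact mul_nonneg (le_max_right _ _) (hpos _ _)
      have h1 : -∑ x', ∑ a', n x' * f x' a' * p x' a' x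
          ≤ ∑ x', ∑ a', max (-n x') 0 * f x' a' * p x' a' x := by
        simp_rw [← Finset.sum_neg_distrib]
        refine Finset.sum_le_sum fun x' _ => Finset.sum_le_sum fun a' _ => ?_
        rw [mul_assoc, mul_assoc, ← neg_mul]
        exact mul_le_mul_of_nonneg_right (le_max_left _ _) (hpos _ _)
      have h2 := mul_le_mul_of_nonneg_left h1 hγ.1.le
      have h3 := mul_nonneg hγ.1.le h0
      refine max_le ?_ (by linarith)
      rw [hn x]
      linarith [hμ0 x])
  rw [Finset.sum_const_zero] at h
  have h4 : max (-n x) 0 ≤ ∑ x, max (-n x) 0 :=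
    Finset.single_le_sum (f := fun x => max (-n x) 0) (fun _ _ => le_max_right _ _)
      (Finset.mem_univ x)
  have h5 : ∑ x, max (-n x) 0 ≤ 0 := by
    by_contra! hc
    have := mul_pos (sub_pos.2 hγ.2) hc
    linarith
  linarith [le_max_left (-n x) 0]

theorem visit_eq_zero_of_pos_policy {X A : Type*} [Fintype X] [Fintype A]
    {p : X → A → X → ℝ} {μ : X → ℝ} {γ : ℝ}
    (hp0 : ∀ x a x', 0 ≤ p x a x') (hp1 : ∀ x a, ∑ x', p x a x' = 1)
    (hμ0 : ∀ x, 0 ≤ μ x) (hγ : 0 < γ ∧ γ < 1)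
    {f g : X → A → ℝ} (hf : IsPolicy f) (hfpos : ∀ x a, 0 < f x a) (hg : IsPolicy g)
    {n m : X → ℝ}
    (hn : ∀ x, n x = μ x + γ * ∑ x', ∑ a', n x' * f x' a' * p x' a' x)
    (hm : ∀ x, m x = μ x + γ * ∑ x', ∑ a', m x' * g x' a' * p x' a' x)
    {x : X} (hx : n x = 0) : m x = 0 := by
  have n0 := visit_nonneg hp0 hp1 hμ0 hγ hf hn
  have m0 := visit_nonneg hp0 hp1 hμ0 hγ hg hm
  have w0 : ∀ y, 0 ≤ (if n y = 0 then m y else 0) := fun y => by split_ifs <;> simp [m0]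
  have h := sum_le_of_le_add_mul_transition hp1 hg (γ := γ)
    (w := fun y => if n y = 0 then m y else 0) (b := fun _ => 0) (fun y => by
      by_cases hy : n y = 0
      · have hpos : ∀ x' a', 0 ≤ n x' * f x' a' * p x' a' y :=
          fun x' a' => mul_nonneg (mul_nonneg (n0 _) (hf.1 _ _)) (hp0 _ _ _)
        have hsum := Finset.sum_nonneg fun x' (_ : x' ∈ Finset.univ) =>
          Finset.sum_nonneg fun a' (_ : a' ∈ Finset.univ) => hpos x' a'
        have h1 := hn y
        rw [hy] at h1
        have h2 := mul_nonneg hγ.1.le hsum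
        have hμy : μ y = 0 := le_antisymm (by linarith) (hμ0 y)
        have hz : ∑ x', ∑ a', n x' * f x' a' * p x' a' y = 0 := by
          have : γ * ∑ x', ∑ a', n x' * f x' a' * p x' a' y = 0 := by linarith
          exact (mul_eq_zero.1 this).resolve_left hγ.1.ne'
        have hterm : ∀ x' a', n x' * f x' a' * p x' a' y = 0 := fun x' a' => by
          have h3 := (Finset.sum_eq_zero_iff_of_nonneg
            (fun x' _ => Finset.sum_nonneg fun a' _ => hpos x' a')).1 hz x' (Finset.mem_univ _)
          exact (Finset.sum_eq_zero_iff_of_nonneg (fun a' _ => hpos x' a')).1 h3 a'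
            (Finset.mem_univ _)
        simp only [hy, if_true]
        rw [hm y, hμy]
        refine le_of_eq ?_
        congr 2
        refine Finset.sum_congr rfl fun x' _ => Finset.sum_congr rfl fun a' _ => ?_
        by_cases hx' : n x' = 0
        · simp [hx']
        · have h4 : p x' a' y = 0 := by
            simpa [hx', (hfpos x' a').ne'] using hterm x' a'
          simp [h4]
      · simp only [hy, if_false, zero_add]
        exact mul_nonneg hγ.1.le (Finset.sum_nonneg fun x' _ => Finset.sum_nonneg fun a' _ =>
          mul_nonneg (mul_nonneg (w0 _) (hg.1 _ _)) (hp0 _ _ _)))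
  rw [Finset.sum_const_zero] at h
  have h4 := Finset.single_le_sum (f := fun y => if n y = 0 then m y else 0)
    (fun y _ => w0 y) (Finset.mem_univ x)
  simp only [hx, if_true] at h4
  by_contra hc
  have hmx : 0 < m x := lt_of_le_of_ne (m0 x) (Ne.symm hc)
  have := mul_pos (sub_pos.2 hγ.2) (hmx.trans_le h4)
  linarith

theorem sum_abs_visit_sub_le {X A : Type*} [Fintype X] [Fintype A]
    {p : X → A → X → ℝ} {μ : X → ℝ} {γ : ℝ}
    (hp0 : ∀ x a x', 0 ≤ p x a x') (hp1 : ∀ x a, ∑ x', p x a x' = 1)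
    (hγ : 0 < γ ∧ γ < 1)
    {f g : X → A → ℝ} (hg : IsPolicy g) {n m : X → ℝ}
    (hn : ∀ x, n x = μ x + γ * ∑ x', ∑ a', n x' * f x' a' * p x' a' x)
    (hm : ∀ x, m x = μ x + γ * ∑ x', ∑ a', m x' * g x' a' * p x' a' x) :
    (1 - γ) * ∑ x, |m x - n x| ≤
      ∑ x, γ * ∑ x', ∑ a', |n x'| * |g x' a' - f x' a'| * p x' a' x := by
  refine sum_le_of_le_add_mul_transition hp1 hg fun x => ?_
  have h1 : m x - n x = γ * ∑ x', ∑ a',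
      (n x' * (g x' a' - f x' a') * p x' a' x + (m x' - n x') * g x' a' * p x' a' x) := by
    rw [hm x, hn x, add_sub_add_left_eq_sub, ← mul_sub, ← Finset.sum_sub_distrib]
    congr 1
    refine Finset.sum_congr rfl fun x' _ => ?_
    rw [← Finset.sum_sub_distrib]
    exact Finset.sum_congr rfl fun a' _ => by ring
  rw [h1, abs_mul, abs_of_pos hγ.1, ← mul_add, ← Finset.sum_add_distrib]
  refine mul_le_mul_of_nonneg_left ?_ hγ.1.le
  refine (Finset.abs_sum_le_sum_abs _ _).trans (Finset.sum_le_sum fun x' _ => ?_)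
  rw [← Finset.sum_add_distrib]
  refine (Finset.abs_sum_le_sum_abs _ _).trans (Finset.sum_le_sum fun a' _ => ?_)
  refine (abs_add_le _ _).trans (le_of_eq ?_)
  simp only [abs_mul, abs_of_nonneg (hg.1 x' a'), abs_of_nonneg (hp0 x' a' x)]

theorem tendsto_visit {X A ι : Type*} [Fintype X] [Fintype A]
    {p : X → A → X → ℝ} {μ : X → ℝ} {γ : ℝ}
    (hp0 : ∀ x a x', 0 ≤ p x a x') (hp1 : ∀ x a, ∑ x', p x a x' = 1)
    (hγ : 0 < γ ∧ γ < 1)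
    {nu : (X → A → ℝ) → X → ℝ}
    (hnu : ∀ f : X → A → ℝ, IsPolicy f → ∀ x,
      nu f x = μ x + γ * ∑ x', ∑ a', nu f x' * f x' a' * p x' a' x)
    {f : X → A → ℝ} (hf : IsPolicy f) {g : ι → X → A → ℝ} (hg : ∀ i, IsPolicy (g i))
    {l : Filter ι} (hlim : ∀ x a, Tendsto (fun i => g i x a) l (nhds (f x a))) (x : X) :
    Tendsto (fun i => nu (g i) x) l (nhds (nu f x)) := by
  have hB : Tendsto (fun i => (1 - γ)⁻¹ * ∑ x, γ * ∑ x', ∑ a',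
      |nu f x'| * |g i x' a' - f x' a'| * p x' a' x) l (nhds ((1 - γ)⁻¹ * ∑ x, γ * ∑ x', ∑ a',
      |nu f x'| * |f x' a' - f x' a'| * p x' a' x)) := by
    refine (tendsto_finsetSum _ fun x _ => (tendsto_finsetSum _ fun x' _ =>
      tendsto_finsetSum _ fun a' _ => ?_).const_mul _).const_mul _
    exact ((((hlim x' a').sub_const _).abs).const_mul _).mul_const _
  simp only [sub_self, abs_zero, mul_zero, zero_mul, Finset.sum_const_zero] at hB
  rw [tendsto_iff_dist_tendsto_zero]
  refine squeeze_zero (fun _ => dist_nonneg) (fun i => ?_) hB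
  have h := sum_abs_visit_sub_le hp0 hp1 hγ (hg i) (hnu f hf) (hnu (g i) (hg i))
  have h1 := Finset.single_le_sum (f := fun y => |nu (g i) y - nu f y|)
    (fun y _ => abs_nonneg _) (Finset.mem_univ x)
  rw [Real.dist_eq, inv_mul_eq_div, le_div_iff₀ (sub_pos.2 hγ.2), mul_comm]
  exact (mul_le_mul_of_nonneg_left h1 (sub_pos.2 hγ.2).le).trans h

theorem sum_visit_mul_bellman_residual {X A : Type*} [Fintype X] [Fintype A]
    {p : X → A → X → ℝ} {μ : X → ℝ} {r : X → A → ℝ} {γ : ℝ}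
    {g : X → A → ℝ} (hg : IsPolicy g) {m : X → ℝ}
    (hm : ∀ x, m x = μ x + γ * ∑ x', ∑ a', m x' * g x' a' * p x' a' x) (U : X → ℝ) :
    ∑ x, m x * ∑ a, g x a * (r x a + γ * ∑ x', p x a x' * U x' - U x) =
      ∑ x, m x * ∑ a, g x a * r x a - ∑ x, μ x * U x := by
  have h1 : ∀ x, m x * ∑ a, g x a * (r x a + γ * ∑ x', p x a x' * U x' - U x) =
      m x * ∑ a, g x a * r x a + γ * (∑ x', ∑ a, m x * g x a * p x a x' * U x') - m x * U x := by
    intro x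
    have : ∑ a, g x a * U x = U x := by rw [← Finset.sum_mul, hg.2, one_mul]
    simp_rw [mul_sub, mul_add, Finset.sum_sub_distrib, Finset.sum_add_distrib, this]
    rw [mul_sub, mul_add, Finset.sum_comm]
    congr 2
    simp_rw [Finset.mul_sum]
    exact Finset.sum_congr rfl fun a _ => Finset.sum_congr rfl fun x' _ => by ring
  have h2 : ∑ x, m x * U x =
      ∑ x, μ x * U x + γ * ∑ x, ∑ x', ∑ a, m x * g x a * p x a x' * U x' := by
    rw [Finset.sum_comm, Finset.mul_sum, ← Finset.sum_add_distrib]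
    refine Finset.sum_congr rfl fun y _ => ?_
    conv_lhs => rw [hm y]
    simp_rw [add_mul, mul_assoc γ, ← Finset.sum_mul]
  simp_rw [h1, Finset.sum_sub_distrib, Finset.sum_add_distrib, ← Finset.mul_sum]
  rw [h2]
  ring

theorem performance_difference {X A : Type*} [Fintype X] [Fintype A]
    {p : X → A → X → ℝ} {μ : X → ℝ} {r : X → A → ℝ} {γ : ℝ}
    {Vq : (X → A → ℝ) → X → A → ℝ}
    (hVq : ∀ f : X → A → ℝ, IsPolicy f → ∀ x a,
      Vq f x a = r x a + γ * ∑ x', p x a x' * ∑ a', f x' a' * Vq f x' a')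
    {J : (X → A → ℝ) → ℝ}
    (hJ : ∀ f : X → A → ℝ, IsPolicy f → J f = ∑ x, μ x * ∑ a, f x a * Vq f x a)
    {nu : (X → A → ℝ) → X → ℝ}
    (hnu : ∀ f : X → A → ℝ, IsPolicy f → ∀ x,
      nu f x = μ x + γ * ∑ x', ∑ a', nu f x' * f x' a' * p x' a' x)
    {f g : X → A → ℝ} (hf : IsPolicy f) (hg : IsPolicy g) :
    J g - J f = ∑ x, nu g x * ∑ a, g x a * (Vq f x a - ∑ b, f x b * Vq f x b) := by
  have key : ∀ h : X → A → ℝ, IsPolicy h →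
      ∑ x, nu g x * ∑ a, g x a * (Vq h x a - ∑ b, h x b * Vq h x b) =
        ∑ x, nu g x * ∑ a, g x a * r x a - J h := fun h hh => by
    rw [hJ h hh, ← sum_visit_mul_bellman_residual hg (hnu g hg)]
    refine Finset.sum_congr rfl fun x _ => ?_
    congr 1
    exact Finset.sum_congr rfl fun a _ => by rw [← hVq h hh]
  have hz : ∑ x, nu g x * ∑ a, g x a * (Vq g x a - ∑ b, g x b * Vq g x b) = 0 := by
    refine Finset.sum_eq_zero fun x _ => ?_
    simp_rw [mul_sub, Finset.sum_sub_distrib, ← Finset.sum_mul, hg.2, one_mul, sub_self, mul_zero]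
  have h1 := key f hf
  have h2 := key g hg
  linarith

theorem hasDerivAt_mul_of_eq_zero {n φ : ℝ → ℝ} {φ' t : ℝ} (hn : ContinuousAt n t)
    (hφ : HasDerivAt φ φ' t) (h0 : φ t = 0) :
    HasDerivAt (fun u => n u * φ u) (n t * φ') t := by
  rw [hasDerivAt_iff_tendsto_slope] at hφ ⊢
  refine ((hn.tendsto.mono_left nhdsWithin_le_nhds).mul hφ).congr fun u => ?_
  simp only [slope_def_field, h0]
  ring

theorem hasDerivAt_softmax_average {A : Type*} [Fintype A] [DecidableEq A] [Nonempty A]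
    (τ c : A → ℝ) (a : A) (h0 : ∑ b, Real.exp (τ b) * c b = 0) :
    HasDerivAt (fun u : ℝ => (∑ b, Real.exp (if b = a then u else τ b) * c b) /
        ∑ b, Real.exp (if b = a then u else τ b))
      (Real.exp (τ a) / (∑ b, Real.exp (τ b)) * c a) (τ a) := by
  have hself : ∀ b, (if b = a then τ a else τ b) = τ b := fun b => by
    split_ifs with h
    · rw [h]
    · rfl
  have hE : ∀ b, HasDerivAt (fun u : ℝ => Real.exp (if b = a then u else τ b))
      (if b = a then Real.exp (τ a) else 0) (τ a) := fun b => by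
    by_cases h : b = a
    · simpa [h] using Real.hasDerivAt_exp (τ a)
    · simpa [h] using hasDerivAt_const (τ a) (Real.exp (τ b))
  have hN := HasDerivAt.fun_sum (u := Finset.univ) fun b _ => (hE b).mul_const (c b)
  have hD := HasDerivAt.fun_sum (u := Finset.univ) fun b _ => hE b
  have hpos : 0 < ∑ b, Real.exp (τ b) :=
    Finset.sum_pos (fun _ _ => Real.exp_pos _) Finset.univ_nonempty
  have h := hN.fun_div hD (by simp only [hself]; exact hpos.ne')
  simp only [hself, h0, zero_mul, sub_zero, ite_mul, Finset.sum_ite_eq', Finset.mem_univ,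
    if_true] at h
  rw [sq, mul_div_mul_right _ _ hpos.ne', ← div_mul_eq_mul_div] at h
  exact h

theorem hasDerivAt_objective_softmaxPol {X A : Type*} [Fintype X] [Fintype A] [Nonempty A]
    [DecidableEq X] [DecidableEq A]
    {p : X → A → X → ℝ} {μ : X → ℝ} {r : X → A → ℝ} {γ : ℝ}
    (hp0 : ∀ x a x', 0 ≤ p x a x') (hp1 : ∀ x a, ∑ x', p x a x' = 1)
    (hγ : 0 < γ ∧ γ < 1)
    {Vq : (X → A → ℝ) → X → A → ℝ}
    (hVq : ∀ f : X → A → ℝ, IsPolicy f → ∀ x a,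
      Vq f x a = r x a + γ * ∑ x', p x a x' * ∑ a', f x' a' * Vq f x' a')
    {J : (X → A → ℝ) → ℝ}
    (hJ : ∀ f : X → A → ℝ, IsPolicy f → J f = ∑ x, μ x * ∑ a, f x a * Vq f x a)
    {nu : (X → A → ℝ) → X → ℝ}
    (hnu : ∀ f : X → A → ℝ, IsPolicy f → ∀ x,
      nu f x = μ x + γ * ∑ x', ∑ a', nu f x' * f x' a' * p x' a' x)
    (θ : X → A → ℝ) (x : X) (a : A) :
    HasDerivAt
      (fun u : ℝ => J (softmaxPol (fun x' a' => if x' = x ∧ a' = a then u else θ x' a')))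
      (nu (softmaxPol θ) x * (softmaxPol θ x a *
        (Vq (softmaxPol θ) x a - ∑ b, softmaxPol θ x b * Vq (softmaxPol θ) x b))) (θ x a) := by
  set f := softmaxPol θ with hfdef
  set g : ℝ → X → A → ℝ :=
    fun u => softmaxPol (fun x' a' => if x' = x ∧ a' = a then u else θ x' a') with hgdef
  set c : X → A → ℝ := fun y b => Vq f y b - ∑ b, f y b * Vq f y b with hcdef
  have hf : IsPolicy f := isPolicy_softmaxPol θ
  have hg : ∀ u, IsPolicy (g u) := fun u => isPolicy_softmaxPol _
  have hgself : g (θ x a) = f := by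
    refine congrArg softmaxPol ?_
    ext x' a'
    split_ifs with h
    · rw [h.1, h.2]
    · rfl
  have hfc : ∀ y, ∑ b, f y b * c y b = 0 := fun y => by
    simp_rw [hcdef, mul_sub, Finset.sum_sub_distrib, ← Finset.sum_mul, hf.2, one_mul, sub_self]
  have hgx : ∀ u b, g u x b = Real.exp (if b = a then u else θ x b) /
      ∑ b, Real.exp (if b = a then u else θ x b) := fun u b => by
    simp only [hgdef, softmaxPol, true_and]
  have hgy : ∀ u y, y ≠ x → g u y = f y := fun u y hy => by
    ext b
    simp only [hgdef, hfdef, softmaxPol, hy, false_and, if_false]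
  have hJg : ∀ u, J (g u) = nu (g u) x * ∑ b, g u x b * c x b + J f := fun u => by
    rw [← sub_eq_iff_eq_add, performance_difference hVq hJ hnu hf (hg u)]
    refine Finset.sum_eq_single x (fun y _ hy => ?_) (fun h => absurd (Finset.mem_univ x) h)
    rw [hgy u y hy]
    exact mul_eq_zero_of_right _ (hfc y)
  have hφ : HasDerivAt (fun u => ∑ b, g u x b * c x b) (f x a * c x a) (θ x a) := by
    have h0 : ∑ b, Real.exp (θ x b) * c x b = 0 := by
      have h1 := hfc x
      simp only [hfdef, softmaxPol, div_mul_eq_mul_div, ← Finset.sum_div] at h1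
      exact (div_eq_zero_iff.1 h1).resolve_right (softmaxPol_denom_pos θ x).ne'
    have h2 := hasDerivAt_softmax_average (θ x) (c x) a h0
    simp_rw [hgx, div_mul_eq_mul_div, ← Finset.sum_div]
    exact h2
  have hlim : ∀ y b, Tendsto (fun u => g u y b) (nhds (θ x a)) (nhds (f y b)) := fun y b => by
    rw [← hgself]
    have hc : ∀ b', Continuous fun u : ℝ =>
        Real.exp (if y = x ∧ b' = a then u else θ y b') := fun b' => by
      split_ifs <;> fun_prop
    have : Continuous fun u => g u y b :=
      (hc b).div (continuous_finsetSum _ fun b' _ => hc b')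
        fun u => (softmaxPol_denom_pos (fun x' a' => if x' = x ∧ a' = a then u else θ x' a') y).ne'
    exact this.tendsto _
  have hν : ContinuousAt (fun u => nu (g u) x) (θ x a) := by
    have h := tendsto_visit hp0 hp1 hγ hnu hf hg hlim x
    rwa [ContinuousAt, hgself]
  have h := (hasDerivAt_mul_of_eq_zero hν hφ (by rw [hgself]; exact hfc x)).add_const (J f)
  rw [hgself] at h
  exact h.congr_of_eventuallyEq (Eventually.of_forall hJg)

theorem abs_sum_le_sqrt_card_mul {X : Type*} [Fintype X] (v : X → ℝ) :
    ∑ x, |v x| ≤ Real.sqrt (Fintype.card X) * Real.sqrt (∑ x, v x ^ 2) := by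
  rw [← Real.sqrt_mul (Nat.cast_nonneg _)]
  refine Real.le_sqrt_of_sq_le ?_
  have h := sq_sum_le_card_mul_sum_sq (s := Finset.univ) (f := fun x => |v x|)
  simpa using h

theorem lojasiewicz_unique_action
    {X A : Type*} [Fintype X] [Fintype A] [Nonempty X] [Nonempty A]
    [DecidableEq X] [DecidableEq A]
    (p : X → A → X → ℝ) (μ : X → ℝ) (r : X → A → ℝ) (γ α : ℝ)
    (hp0 : ∀ x a x', 0 ≤ p x a x') (hp1 : ∀ x a, ∑ x', p x a x' = 1)
    (hμ0 : ∀ x, 0 ≤ μ x) (hμ1 : ∑ x, μ x = 1)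
    (hr : ∀ x a, 0 ≤ r x a ∧ r x a ≤ 1) (hγ : 0 < γ ∧ γ < 1) (hα : 0 < α)
    (Vq : (X → A → ℝ) → X → A → ℝ)
    (hVq : ∀ f : X → A → ℝ, IsPolicy f → ∀ x a,
      Vq f x a = r x a + γ * ∑ x', p x a x' * ∑ a', f x' a' * Vq f x' a')
    (J : (X → A → ℝ) → ℝ)
    (hJ : ∀ f : X → A → ℝ, IsPolicy f → J f = ∑ x, μ x * ∑ a, f x a * Vq f x a)
    (nu : (X → A → ℝ) → X → ℝ)
    (hnu : ∀ f : X → A → ℝ, IsPolicy f → ∀ x,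
      nu f x = μ x + γ * ∑ x', ∑ a', nu f x' * f x' a' * p x' a' x)
    (fstar : X → A → ℝ) (hfstarPol : IsPolicy fstar)
    (hfstarOpt : ∀ f : X → A → ℝ, IsPolicy f → J f ≤ J fstar)
    (astar : X → A) (hdet : ∀ x a, fstar x a = if a = astar x then 1 else 0)
    (θ : X → A → ℝ) (grad : X → A → ℝ)
    (hgrad : ∀ x a, HasDerivAt
      (fun u : ℝ => J (softmaxPol (fun x' a' => if x' = x ∧ a' = a then u else θ x' a')))
      (grad x a) (θ x a)) :
    (Real.sqrt (Fintype.card X : ℝ))⁻¹ *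
      (Finset.univ.sup' Finset.univ_nonempty
        (fun x => nu fstar x / nu (softmaxPol θ) x))⁻¹ *
      (Finset.univ.inf' Finset.univ_nonempty
        (fun x => softmaxPol θ x (astar x))) *
      (J fstar - J (softmaxPol θ))
    ≤ Real.sqrt (∑ x, ∑ a, grad x a ^ 2) := by
  set f := softmaxPol θ with hfdef
  have hf : IsPolicy f := isPolicy_softmaxPol θ
  have hfpos : ∀ x a, 0 < f x a := softmaxPol_pos θ
  set c : X → A → ℝ := fun y b => Vq f y b - ∑ b, f y b * Vq f y b with hcdef
  have hgr : ∀ x a, grad x a = nu f x * (f x a * c x a) := fun x a =>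
    (hgrad x a).unique (hasDerivAt_objective_softmaxPol hp0 hp1 hγ hVq hJ hnu θ x a)
  have n0 := visit_nonneg hp0 hp1 hμ0 hγ hf (hnu f hf)
  have m0 := visit_nonneg hp0 hp1 hμ0 hγ hfstarPol (hnu fstar hfstarPol)
  have hzero : ∀ x, nu f x = 0 → nu fstar x = 0 := fun x =>
    visit_eq_zero_of_pos_policy hp0 hp1 hμ0 hγ hf hfpos hfstarPol (hnu f hf)
      (hnu fstar hfstarPol)
  set M := Finset.univ.sup' Finset.univ_nonempty (fun x => nu fstar x / nu f x) with hM
  set k := Finset.univ.inf' Finset.univ_nonempty (fun x => f x (astar x)) with hk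
  have hMle : ∀ x, nu fstar x / nu f x ≤ M := fun x =>
    Finset.le_sup' (fun x => nu fstar x / nu f x) (Finset.mem_univ x)
  have hkle : ∀ x, k ≤ f x (astar x) := fun x =>
    Finset.inf'_le (fun x => f x (astar x)) (Finset.mem_univ x)
  have hk0 : 0 ≤ k := Finset.le_inf' _ _ fun x _ => (hfpos x _).le
  have hνle : ∀ x, nu fstar x ≤ M * nu f x := fun x => by
    rcases (n0 x).eq_or_lt with h | h
    · rw [hzero x h.symm, ← h, mul_zero]
    · exact (div_le_iff₀ h).1 (hMle x)
  have hM0 : 0 ≤ M := by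
    obtain ⟨x⟩ := ‹Nonempty X›
    exact (div_nonneg (m0 x) (n0 x)).trans (hMle x)
  have hgap : J fstar - J f = ∑ x, nu fstar x * c x (astar x) := by
    rw [performance_difference hVq hJ hnu hf hfstarPol]
    refine Finset.sum_congr rfl fun x _ => ?_
    simp [hdet, hcdef]
  have hbound : k * (J fstar - J f) ≤ M * ∑ x, |grad x (astar x)| := by
    rw [hgap, Finset.mul_sum, Finset.mul_sum]
    refine Finset.sum_le_sum fun x _ => ?_
    rw [hgr, abs_mul, abs_mul, abs_of_nonneg (n0 x), abs_of_pos (hfpos x _)]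
    calc k * (nu fstar x * c x (astar x))
        ≤ k * ((M * nu f x) * |c x (astar x)|) := by
          refine mul_le_mul_of_nonneg_left ?_ hk0
          exact (mul_le_mul_of_nonneg_left (le_abs_self _) (m0 x)).trans
            (mul_le_mul_of_nonneg_right (hνle x) (abs_nonneg _))
      _ ≤ f x (astar x) * ((M * nu f x) * |c x (astar x)|) :=
          mul_le_mul_of_nonneg_right (hkle x)
            (mul_nonneg (mul_nonneg hM0 (n0 x)) (abs_nonneg _))
      _ = M * (nu f x * (f x (astar x) * |c x (astar x)|)) := by ring
  have hnorm : Real.sqrt (∑ x, grad x (astar x) ^ 2) ≤ Real.sqrt (∑ x, ∑ a, grad x a ^ 2) :=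
    Real.sqrt_le_sqrt <| Finset.sum_le_sum fun x _ =>
      Finset.single_le_sum (f := fun a => grad x a ^ 2) (fun _ _ => sq_nonneg _)
        (Finset.mem_univ _)
  have hcs := abs_sum_le_sqrt_card_mul fun x => grad x (astar x)
  have hX : 0 < Real.sqrt (Fintype.card X : ℝ) :=
    Real.sqrt_pos.2 (Nat.cast_pos.2 Fintype.card_pos)
  rcases hM0.eq_or_lt with h | hMpos
  · rw [← h]
    simp
  · have h1 : k * (J fstar - J f) ≤
        M * (Real.sqrt (Fintype.card X) * Real.sqrt (∑ x, ∑ a, grad x a ^ 2)) :=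
      hbound.trans (mul_le_mul_of_nonneg_left
        (hcs.trans (mul_le_mul_of_nonneg_left hnorm hX.le)) hM0)
    rw [mul_assoc, ← mul_inv, inv_mul_le_iff₀ (mul_pos hX hMpos)]
    linarith
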